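/- arXiv:2402.08848 — 4 statements merged into one kernel-verified Lean document; each statement's English description precedes it below -/
import Mathlib

section
/- Suppose the policy sequence satisfies the expert-relative regret guarantee with bound Reg_π(T), i.e. Σ_{t=1}^T (J(π_E, f_t) − J(π_t, f_t)) ≤ Reg_π(T), and the reward sequence satisfies the no-regret guarantee with bound Reg_f(T), i.e. Σ_{t=1}^T ℓ_t(f_t) − Σ_{t=1}^T ℓ_t(f★) ≤ Reg_f(T) for every f★ ∈ F_r. Then the average suboptimality of the policy sequence under the ground-truth reward satisfies (1/T) · Σ_{t=1}^T (J(π_E, r) − J(π_t, r)) ≤ Reg_π(T)/T + (Reg_f(T)/T) · H. -/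
/-- **Theorem 3.4 (reduction from inverse RL to expert-competitive RL).**
If the policy sequence satisfies the expert-relative regret guarantee with bound
`Regπ` and the reward sequence satisfies the no-regret guarantee with bound `Regf`
(for the losses `ℓ t f = (1/H) * (J (π t) f - J πE f)`), then the average
suboptimality under the ground-truth reward `r` is at most
`Regπ/T + (Regf/T) * H`. -/
theorem hybrid_irl_avg_bound
    {Pol Rew : Type*} [Nonempty Pol] [Nonempty Rew]
    (Fr : Set Rew) (J : Pol → Rew → ℝ)
    (πE : Pol) (r : Rew) (hr : r ∈ Fr)
    (H : ℝ) (hH : 0 < H)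
    (T : ℕ) (hT : 1 ≤ T)
    (π : Fin T → Pol) (f : Fin T → Rew) (hf : ∀ t, f t ∈ Fr)
    (Regπ Regf : ℝ)
    (hpol : ∑ t, (J πE (f t) - J (π t) (f t)) ≤ Regπ)
    (hrew : ∀ fs ∈ Fr,
      (∑ t, (1 / H) * (J (π t) (f t) - J πE (f t))) -
        (∑ t, (1 / H) * (J (π t) fs - J πE fs)) ≤ Regf) :
    (1 / (T : ℝ)) * ∑ t, (J πE r - J (π t) r) ≤ Regπ / T + (Regf / T) * H := by
  have hT_pos : (0 : ℝ) < T := by exact_mod_cast hT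
  have hreg := hrew r hr
  rw [← Finset.mul_sum, ← Finset.mul_sum, ← mul_sub, one_div_mul_eq_div, div_le_iff₀ hH] at hreg
  simp only [Finset.sum_sub_distrib] at hreg hpol ⊢
  rw [one_div_mul_eq_div, div_mul_eq_mul_div, ← add_div]
  gcongr
  linarith
end

section
/- Suppose the policy sequence satisfies the expert-relative regret guarantee with bound Reg_π(T), i.e. Σ_{t=1}^T (J(π_E, f_t) − J(π_t, f_t)) ≤ Reg_π(T), and the reward sequence satisfies the no-regret guarantee with bound Reg_f(T), i.e. Σ_{t=1}^T ℓ_t(f_t) − Σ_{t=1}^T ℓ_t(f★) ≤ Reg_f(T) for every f★ ∈ F_r. Then there exists an index t ∈ {1, …, T} such that J(π_E, r) − J(π_t, r) ≤ Reg_π(T)/T + (Reg_f(T)/T) · H; i.e. the best iterate of the policy sequence achieves the bound on suboptimality under the ground-truth reward. -/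
/-- **Best-iterate version of the reduction from inverse RL to expert-competitive RL.**
Under the expert-relative regret guarantee for the policies and the no-regret
guarantee for the rewards, there exists an iterate `π t` whose suboptimality
under the ground-truth reward `r` is at most `Regπ/T + (Regf/T) * H`. -/
theorem hybrid_irl_best_iterate_bound
    {Pol Rew : Type*} [Nonempty Pol] [Nonempty Rew]
    (Fr : Set Rew) (J : Pol → Rew → ℝ)
    (πE : Pol) (r : Rew) (hr : r ∈ Fr)
    (H : ℝ) (hH : 0 < H)
    (T : ℕ) (hT : 1 ≤ T)
    (π : Fin T → Pol) (f : Fin T → Rew) (hf : ∀ t, f t ∈ Fr)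
    (Regπ Regf : ℝ)
    (hpol : ∑ t, (J πE (f t) - J (π t) (f t)) ≤ Regπ)
    (hrew : ∀ fs ∈ Fr,
      (∑ t, (1 / H) * (J (π t) (f t) - J πE (f t))) -
        (∑ t, (1 / H) * (J (π t) fs - J πE fs)) ≤ Regf) :
    ∃ t : Fin T, J πE r - J (π t) r ≤ Regπ / T + (Regf / T) * H := by
  have hT0 : (0 : ℝ) < T := by exact_mod_cast hT
  have hr' := hrew r hr
  rw [← Finset.mul_sum, ← Finset.mul_sum, ← mul_sub, one_div, inv_mul_le_iff₀ hH] at hr'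
  have hsum : ∑ t, (J πE r - J (π t) r) ≤ ∑ _t : Fin T, (Regπ / T + (Regf / T) * H) := by
    have hconst : ∑ _t : Fin T, (Regπ / T + (Regf / T) * H) = Regπ + H * Regf := by
      rw [Finset.sum_const, Finset.card_univ, Fintype.card_fin, nsmul_eq_mul]
      field_simp
    simp only [Finset.sum_sub_distrib] at hpol hr' ⊢
    linarith
  have : Nonempty (Fin T) := ⟨⟨0, hT⟩⟩
  obtain ⟨t, -, ht⟩ := Finset.exists_le_of_sum_le Finset.univ_nonempty hsum
  exact ⟨t, ht⟩
end

section
/- (HyPE performance bound.) Let C ≥ 0 and M ≥ 1, and suppose each policy iterate satisfies the per-iteration HyQ guarantee J(π_E, f_t) − J(π_t, f_t) ≤ C · H² / √M for every t ∈ {1, …, T}, and the reward sequence satisfies the no-regret guarantee with bound Reg_f(T), i.e. Σ_{t=1}^T ℓ_t(f_t) − Σ_{t=1}^T ℓ_t(f★) ≤ Reg_f(T) for every f★ ∈ F_r. Then (1/T) · Σ_{t=1}^T (J(π_E, r) − J(π_t, r)) ≤ C · H² / √M + (Reg_f(T)/T) · H. -/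
/-- **HyPE performance bound.** If each policy iterate satisfies the per-iteration
HyQ guarantee `J(πE, f t) - J(π t, f t) ≤ C * H² / √M` and the reward sequence is
no-regret with bound `Regf`, then the average suboptimality under the ground-truth
reward `r` is at most `C * H² / √M + (Regf/T) * H`. -/
theorem hype_performance_bound
    {Pol Rew : Type*} [Nonempty Pol] [Nonempty Rew]
    (Fr : Set Rew) (J : Pol → Rew → ℝ)
    (πE : Pol) (r : Rew) (hr : r ∈ Fr)
    (H : ℝ) (hH : 0 < H)
    (T : ℕ) (hT : 1 ≤ T)
    (π : Fin T → Pol) (f : Fin T → Rew) (hf : ∀ t, f t ∈ Fr)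
    (C M : ℝ) (hC : 0 ≤ C) (hM : 1 ≤ M)
    (Regf : ℝ)
    (hpol : ∀ t : Fin T, J πE (f t) - J (π t) (f t) ≤ C * H ^ 2 / Real.sqrt M)
    (hrew : ∀ fs ∈ Fr,
      (∑ t, (1 / H) * (J (π t) (f t) - J πE (f t))) -
        (∑ t, (1 / H) * (J (π t) fs - J πE fs)) ≤ Regf) :
    (1 / (T : ℝ)) * ∑ t, (J πE r - J (π t) r) ≤
      C * H ^ 2 / Real.sqrt M + (Regf / T) * H := by
  have hT0 : (0 : ℝ) < T := by exact_mod_cast hT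
  set K := C * H ^ 2 / Real.sqrt M
  have hreg := hrew r hr
  rw [← Finset.mul_sum, ← Finset.mul_sum, ← mul_sub, one_div_mul_eq_div, div_le_iff₀ hH] at hreg
  have hsum : ∑ t, (J πE (f t) - J (π t) (f t)) ≤ T * K := by
    simpa using Finset.sum_le_sum fun t (_ : t ∈ Finset.univ) => hpol t
  simp only [Finset.sum_sub_distrib] at hreg hsum ⊢
  rw [one_div_mul_eq_div, div_le_iff₀ hT0]
  have hrhs : (K + Regf / T * H) * T = T * K + Regf * H := by
    field_simp
  linarith
end

section
/- (HyPER performance bound.) Let ε̄_π ≥ 0 and ε̄_M ≥ 0, and suppose the policy sequence satisfies the average expert-relative guarantee (1/T) · Σ_{t=1}^T (J(π_E, f_t) − J(π_t, f_t)) ≤ (ε̄_π + 2·√(ε̄_M)) · H², and the reward sequence satisfies the no-regret guarantee with bound Reg_f(T), i.e. Σ_{t=1}^T ℓ_t(f_t) − Σ_{t=1}^T ℓ_t(f★) ≤ Reg_f(T) for every f★ ∈ F_r. Then (1/T) · Σ_{t=1}^T (J(π_E, r) − J(π_t, r)) ≤ (ε̄_π + 2·√(ε̄_M)) · H² + (Reg_f(T)/T)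 · H. -/
/-- **HyPER performance bound.** If the policy sequence satisfies the average
expert-relative guarantee `(1/T) Σ (J(πE, f t) - J(π t, f t)) ≤ (ε̄π + 2√ε̄M) H²`
and the reward sequence is no-regret with bound `Regf`, then the average
suboptimality under the ground-truth reward `r` is at most
`(ε̄π + 2√ε̄M) H² + (Regf/T) H`. -/
theorem hyper_performance_bound
    {Pol Rew : Type*} [Nonempty Pol] [Nonempty Rew]
    (Fr : Set Rew) (J : Pol → Rew → ℝ)
    (πE : Pol) (r : Rew) (hr : r ∈ Fr)
    (H : ℝ) (hH : 0 < H)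
    (T : ℕ) (hT : 1 ≤ T)
    (π : Fin T → Pol) (f : Fin T → Rew) (hf : ∀ t, f t ∈ Fr)
    (επ εM : ℝ) (hεπ : 0 ≤ επ) (hεM : 0 ≤ εM)
    (Regf : ℝ)
    (hpol : (1 / (T : ℝ)) * ∑ t, (J πE (f t) - J (π t) (f t)) ≤
      (επ + 2 * Real.sqrt εM) * H ^ 2)
    (hrew : ∀ fs ∈ Fr,
      (∑ t, (1 / H) * (J (π t) (f t) - J πE (f t))) -
        (∑ t, (1 / H) * (J (π t) fs - J πE fs)) ≤ Regf) :
    (1 / (T : ℝ)) * ∑ t, (J πE r - J (π t) r) ≤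
      (επ + 2 * Real.sqrt εM) * H ^ 2 + (Regf / T) * H := by
  have hreg := hrew r hr
  rw [← Finset.mul_sum, ← Finset.mul_sum, ← mul_sub, one_div_mul_eq_div, div_le_iff₀ hH] at hreg
  have hsum : ∑ t, (J πE r - J (π t) r) ≤
      ∑ t, (J πE (f t) - J (π t) (f t)) + Regf * H := by
    simp only [Finset.sum_sub_distrib] at hreg ⊢
    linarith
  calc (1 / (T : ℝ)) * ∑ t, (J πE r - J (π t) r)
      ≤ (1 / (T : ℝ)) * (∑ t, (J πE (f t) - J (π t) (f t)) + Regf * H) := by gcongr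
    _ = (1 / (T : ℝ)) * ∑ t, (J πE (f t) - J (π t) (f t)) + (Regf / T) * H := by ring
    _ ≤ (επ + 2 * Real.sqrt εM) * H ^ 2 + (Regf / T) * H := by gcongr
end
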